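/- arXiv:2101.10479 — 7 statements merged into one kernel-verified Lean document; each statement's English description precedes it below -/
import Mathlib

section
/- Let X be a measurable space. Equip Multiset X and Multiset (Multiset X) with their bag σ-algebras (for Multiset (Multiset X), the generating sets use measurable subsets of Multiset X). Then the multiplication of the bag monad, i.e. the join map μ^B : Multiset (Multiset X) → Multiset X sending a bag of bags to their multiplicity-respecting union, is measurable. -/
open MeasureTheory
open scoped ENNReal

/-- `bagA U k` is the set `A^U_k` of bags with exactly `k` elements
(counted with multiplicity) lying in `U`. -/
def bagA {X : Type*} (U : Set X) (k : ℕ) : Set (Multiset X) :=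
  {b | @Multiset.countP X (· ∈ U) (Classical.decPred _) b = k}

/-- The bag σ-algebra on `Multiset X`, generated by the sets `A^U_k`
for `U` measurable and `k : ℕ`. -/
instance bagMeasurableSpace (X : Type*) [MeasurableSpace X] : MeasurableSpace (Multiset X) :=
  MeasurableSpace.generateFrom {A | ∃ (U : Set X) (k : ℕ), MeasurableSet U ∧ A = bagA U k}

/-- Counting the elements of a bag that lie in a measurable set is measurable. -/
theorem measurable_countP_mem {X : Type*} [MeasurableSpace X] {U : Set X}
    [DecidablePred (· ∈ U)] (hU : MeasurableSet U) :
    Measurable fun b : Multiset X => b.countP (· ∈ U) := by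
  refine measurable_to_countable' fun k => ?_
  refine MeasurableSpace.measurableSet_generateFrom ⟨U, k, hU, ?_⟩
  ext b
  simp only [bagA, Set.mem_preimage, Set.mem_singleton_iff, Set.mem_ofPred_eq]
  convert Iff.rfl

/-- Layer-cake formula for the sum of a natural-valued function over a bag. -/
theorem sum_map_eq_tsum_countP {Y : Type*} (g : Y → ℕ) (B : Multiset Y) :
    ((B.map g).sum : ℝ≥0∞) = ∑' j : ℕ, (B.countP (j < g ·) : ℝ≥0∞) := by
  induction B using Multiset.induction_on with
  | empty => simp
  | cons a B ih =>
    have layer : (g a : ℝ≥0∞) = ∑' j : ℕ, if j < g a then 1 else 0 := by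
      rw [tsum_eq_sum (s := Finset.range (g a)) (by simp +contextual)]
      simp +contextual [Finset.filter_true_of_mem]
    simp only [Multiset.map_cons, Multiset.sum_cons, Nat.cast_add, Multiset.countP_cons,
      ENNReal.tsum_add, ih, layer]
    rw [add_comm]
    simp

/-- Summing a measurable natural-valued function over a bag is measurable. -/
theorem measurable_sum_map {Y : Type*} [MeasurableSpace Y] {g : Y → ℕ} (hg : Measurable g) :
    Measurable fun B : Multiset Y => (B.map g).sum := by
  classical
  have h : Measurable fun B : Multiset Y => ((B.map g).sum : ℝ≥0∞) := by
    simp only [sum_map_eq_tsum_countP]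
    exact Measurable.tsum fun j =>
      measurable_from_top.comp
        (measurable_countP_mem (U := {y | j < g y}) (measurableSet_lt measurable_const hg))
  refine measurable_to_countable' fun k => ?_
  convert h (measurableSet_singleton (k : ℝ≥0∞)) using 1
  ext B
  simp only [Set.mem_preimage, Set.mem_singleton_iff, Nat.cast_inj]

/-- The multiplication of the bag monad, the join map, is measurable. -/
theorem bag_join_measurable {X : Type*} [MeasurableSpace X] :
    Measurable (Multiset.join : Multiset (Multiset X) → Multiset X) := by
  classical
  refine measurable_generateFrom ?_
  rintro _ ⟨U, k, hU, rfl⟩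
  convert measurable_sum_map (measurable_countP_mem hU) (measurableSet_singleton k) using 1
  ext B
  have h : B.join.countP (· ∈ U) = (B.map fun b => b.countP (· ∈ U)).sum := by
    induction B using Multiset.induction_on with
    | empty => simp
    | cons b B ih => simp [ih]
  simp only [bagA, Set.mem_preimage, Set.mem_singleton_iff, Set.mem_ofPred_eq, ← h]
end

section
/- Let X and Y be measurable spaces, each Multiset space equipped with its bag σ-algebra, and let f : X → Y be a measurable function. Then the component-wise application Multiset.map f : Multiset X → Multiset Y is measurable. (This is the action of the bag functor B on morphisms, lifting B to an endofunctor on the category of measurable spaces.) -/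
open MeasureTheory
open scoped ENNReal

/-- The preimage of `bagA U k` under `Multiset.map f` is `bagA (f ⁻¹' U) k`. -/
theorem preimage_map_bagA {X Y : Type*} (f : X → Y) (U : Set Y) (k : ℕ) :
    Multiset.map f ⁻¹' bagA U k = bagA (f ⁻¹' U) k := by
  ext b
  simp only [bagA, Set.mem_preimage, Set.mem_ofPred_eq,
    Multiset.countP_eq_card_filter, Multiset.filter_map, Multiset.card_map, Function.comp_def]
  rfl

/-- The action of the bag functor on a measurable map is measurable. -/
theorem bag_map_measurable {X Y : Type*} [MeasurableSpace X] [MeasurableSpace Y]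
    {f : X → Y} (hf : Measurable f) :
    Measurable (Multiset.map f : Multiset X → Multiset Y) := by
  refine measurable_generateFrom ?_
  rintro _ ⟨U, k, hU, rfl⟩
  rw [preimage_map_bagA]
  exact MeasurableSpace.measurableSet_generateFrom ⟨f ⁻¹' U, k, hf hU, rfl⟩
end

section
/- Let X be a measurable space. Let R be the collection of subsets of Multiset X that are countable unions of sets of the form ⋂_{j ∈ J} A^{U_j}_{k_j}, where J is a countable index set, the U_j are pairwise disjoint measurable subsets of X, and k_j ∈ ℕ. Then the σ-algebra generated by R equals the bag σ-algebra on Multiset X, i.e. the σ-algebra generated by all the sets A^U_k for measurable U ⊆ X and k ∈ ℕ. -/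
open MeasureTheory
open scoped ENNReal

/-- A countable intersection of generating sets `A^{U_j}_{k_j}` whose base sets
`U_j` are measurable and pairwise disjoint. -/
def isPiece {X : Type*} [MeasurableSpace X] (P : Set (Multiset X)) : Prop :=
  ∃ (J : Type) (_ : Countable J) (U : J → Set X) (k : J → ℕ),
    (∀ j, MeasurableSet (U j)) ∧ Pairwise (Function.onFun Disjoint U) ∧
    P = ⋂ j, bagA (U j) (k j)

/-- The collection of countable unions of such intersections. -/
def bagRing (X : Type*) [MeasurableSpace X] : Set (Set (Multiset X)) :=
  {P | ∃ C : ℕ → Set (Multiset X), (∀ i, isPiece (C i)) ∧ P = ⋃ i, C i}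

lemma isPiece_bagA {X : Type*} [MeasurableSpace X] {U : Set X} (hU : MeasurableSet U) (k : ℕ) :
    isPiece (bagA U k) :=
  ⟨Unit, inferInstance, fun _ ↦ U, fun _ ↦ k, fun _ ↦ hU, Subsingleton.pairwise,
    (Set.iInter_const _).symm⟩

lemma isPiece.mem_bagRing {X : Type*} [MeasurableSpace X] {P : Set (Multiset X)} (hP : isPiece P) :
    P ∈ bagRing X :=
  ⟨fun _ ↦ P, fun _ ↦ hP, (Set.iUnion_const _).symm⟩

lemma measurableSet_bagA {X : Type*} [MeasurableSpace X] {U : Set X} (hU : MeasurableSet U)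
    (k : ℕ) : MeasurableSet (bagA U k) :=
  MeasurableSpace.measurableSet_generateFrom ⟨U, k, hU, rfl⟩

lemma isPiece.measurableSet {X : Type*} [MeasurableSpace X] {P : Set (Multiset X)}
    (hP : isPiece P) : MeasurableSet P := by
  obtain ⟨J, _, U, k, hU, -, rfl⟩ := hP
  exact MeasurableSet.iInter fun j ↦ measurableSet_bagA (hU j) (k j)

/-- The σ-algebra generated by the ring `bagRing X` is the bag σ-algebra. -/
theorem generateFrom_bagRing {X : Type*} [MeasurableSpace X] :
    MeasurableSpace.generateFrom (bagRing X) = bagMeasurableSpace X := by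
  apply le_antisymm
  · refine MeasurableSpace.generateFrom_le ?_
    rintro _ ⟨C, hC, rfl⟩
    exact MeasurableSet.iUnion fun i ↦ (hC i).measurableSet
  · refine MeasurableSpace.generateFrom_mono ?_
    rintro _ ⟨U, k, hU, rfl⟩
    exact (isPiece_bagA hU k).mem_bagRing
end

section
/- Let X be a measurable space and n ∈ ℕ. The map K_n : (Fin n → X) → Multiset X sending an n-tuple (x_1, …, x_n) to the bag [x_1, …, x_n] of its components is measurable, where Fin n → X carries the product σ-algebra and Multiset X the bag σ-algebra. In particular, the preimage under K_n of each generating set A^U_k is the (measurable) set of n-tuples having exactly k components in U. -/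
open MeasureTheory
open scoped ENNReal

/-- `bagK n` sends an `n`-tuple to the bag of its components. -/
def bagK {X : Type*} (n : ℕ) (x : Fin n → X) : Multiset X :=
  (List.ofFn x : List X)

open Classical in
/-- The number of components of `x` in `U`, written as a sum of indicators. -/
theorem countP_bagK {X : Type*} (U : Set X) (n : ℕ) (x : Fin n → X) :
    Multiset.countP (· ∈ U) (bagK n x) = ∑ i, U.indicator (fun _ => 1) (x i) := by
  rw [bagK, Multiset.coe_countP]
  induction n with
  | zero => simp
  | succ n ih =>
    rw [List.ofFn_succ, List.countP_cons, ih, Fin.sum_univ_succ, add_comm]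
    simp [Set.indicator_apply]

/-- The preimage of `A^U_k` under `K_n` is the set of tuples with exactly `k` components in `U`. -/
theorem bagK_preimage_bagA {X : Type*} (U : Set X) (k n : ℕ) :
    bagK n ⁻¹' bagA U k = {x | ∑ i, U.indicator (fun _ => 1) (x i) = k} := by
  ext x
  rw [Set.mem_ofPred_eq, ← countP_bagK]
  rfl

/-- The map `K_n` from `n`-tuples (with the product σ-algebra) to bags
(with the bag σ-algebra) is measurable. -/
theorem bagK_measurable {X : Type*} [MeasurableSpace X] (n : ℕ) :
    Measurable (bagK n : (Fin n → X) → Multiset X) := by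
  refine measurable_generateFrom ?_
  rintro _ ⟨U, k, hU, rfl⟩
  rw [bagK_preimage_bagA]
  have hsum : Measurable fun x : Fin n → X => ∑ i, U.indicator (fun _ => (1 : ℕ)) (x i) :=
    Finset.measurable_fun_sum _ fun i _ =>
      (measurable_const.indicator hU).comp (measurable_pi_apply i)
  exact hsum (measurableSet_singleton k)
end

section
/- Let X be a standard Borel space. Then the map i^B : Multiset X → Measure X sending a bag [x_1,…,x_n] to the sum of Dirac measures ∑_{i=1}^n δ_{x_i} (counted with multiplicity) is injective: two finite bags of points of X with equal associated counting measures are equal. -/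
open MeasureTheory
open scoped ENNReal

/-- `iB` sends a bag to its counting measure, the multiplicity-respecting
sum of Dirac measures at its elements. -/
noncomputable def iB {X : Type*} [MeasurableSpace X] (b : Multiset X) : Measure X :=
  (b.map Measure.dirac).sum

/-- The measure `iB b` of a singleton is the multiplicity of its point in `b`. -/
theorem iB_singleton {X : Type*} [MeasurableSpace X] [MeasurableSingletonClass X]
    [DecidableEq X] (b : Multiset X) (x : X) :
    iB b {x} = (b.count x : ℝ≥0∞) := by
  induction b using Multiset.induction_on with
  | empty => simp [iB]
  | cons a b ih =>
    have h : iB (a ::ₘ b) = Measure.dirac a + iB b := by simp [iB]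
    rw [h, Measure.add_apply, ih, Measure.dirac_apply' a (measurableSet_singleton x),
      Multiset.count_cons, Nat.cast_add, add_comm]
    by_cases hx : x = a
    · simp [hx]
    · simp [hx, Ne.symm hx]

/-- On a standard Borel space, `i^B` is injective: two finite bags with equal
associated counting measures are equal. -/
theorem iB_injective {X : Type*} [MeasurableSpace X] [StandardBorelSpace X] :
    Function.Injective (iB : Multiset X → Measure X) := by
  classical
  intro b c h
  ext x
  have hx : iB b {x} = iB c {x} := by rw [h]
  rw [iB_singleton, iB_singleton] at hx
  exact_mod_cast hx
end

section
/- Let X be a measurable space. The injection i^B : B → M of the bag monad into the all-measures monad satisfies the multiplication law of a monad morphism: for every bag of bags bb : Multiset (Multiset X), the join of the pushforward along i^B_X of the counting measure i^B_{Multiset X}(bb) on Multiset X equals the counting measure of the joined bag, i.e. Measure.join ((i^B_{Multiset X}(bb)).map i^B_X) = i^B_X(Multiset.join bb). -/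
open MeasureTheory
open scoped ENNReal

theorem iB_apply {X : Type*} [MeasurableSpace X] (b : Multiset X) {U : Set X}
    (hU : MeasurableSet U) :
    iB b U = (@Multiset.countP X (· ∈ U) (Classical.decPred _) b : ℝ≥0∞) := by
  classical
  induction b using Multiset.induction_on with
  | empty => simp [iB]
  | cons a b ih =>
    have h : iB (a ::ₘ b) = Measure.dirac a + iB b := by simp [iB]
    rw [h, Measure.add_apply, ih, Measure.dirac_apply' a hU, Multiset.countP_cons]
    by_cases ha : a ∈ U <;> simp [ha, add_comm]

theorem measurable_iB {X : Type*} [MeasurableSpace X] :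
    Measurable (iB : Multiset X → Measure X) := by
  refine Measure.measurable_of_measurable_coe _ fun U hU => ?_
  simp_rw [iB_apply _ hU]
  refine (measurable_from_top (f := fun k : ℕ => (k : ℝ≥0∞))).comp ?_
  refine measurable_to_countable' fun k => ?_
  exact MeasurableSpace.measurableSet_generateFrom ⟨U, k, hU, rfl⟩

/-- The multiplication law of the monad morphism `i^B : B → M`:
joining the pushforward along `i^B` of the counting measure of a bag of bags
gives the counting measure of the joined bag. -/
theorem iB_monadMorphism_mult {X : Type*} [MeasurableSpace X] (bb : Multiset (Multiset X)) :
    Measure.join (Measure.map iB (iB bb)) = iB bb.join := by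
  ext U hU
  rw [Measure.join_apply hU,
    lintegral_map (Measure.measurable_coe hU) measurable_iB]
  induction bb using Multiset.induction_on with
  | empty => simp [iB]
  | cons b bb ih =>
    have h : iB (b ::ₘ bb) = Measure.dirac b + iB bb := by simp [iB]
    have h' : iB (b ::ₘ bb).join = iB b + iB bb.join := by simp [iB]
    rw [h, h', lintegral_add_measure, ih,
      lintegral_dirac' (f := fun a => iB a U) b
        ((Measure.measurable_coe hU).comp measurable_iB), Measure.add_apply]
end

section
/- (Discrete Wald's Lemma.) Let N and X be probability measures on ℕ. Define the compound distribution γ on ℕ by γ = N.bind (fun n => pushforward along (v ↦ ∑_{i < n} v_i) of the n-fold product measure ⊗_{i : Fin n} X), i.e. γ is the distribution of the sum of N-many i.i.d. draws from X. Then the mean of γ is the product of the means: ∫⁻ k, k dγ = (∫⁻ n, n dN) · (∫⁻ k, k dX), with the identity holding in the extended nonnegative reals. -/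
open MeasureTheory
open scoped ENNReal

/-- The mean of the sum of `n` independent draws from `X` is `n` times the mean of `X`. -/
theorem lintegral_map_sum_pi (X : Measure ℕ) [IsProbabilityMeasure X] (n : ℕ) :
    ∫⁻ k, (k : ℝ≥0∞) ∂(Measure.map (fun v : Fin n → ℕ => ∑ i, v i)
        (Measure.pi fun _ : Fin n => X))
      = n * ∫⁻ k, (k : ℝ≥0∞) ∂X := by
  have eval_mean (i : Fin n) :
      ∫⁻ v, (v i : ℝ≥0∞) ∂(Measure.pi fun _ : Fin n => X) = ∫⁻ k, (k : ℝ≥0∞) ∂X :=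
    (measurePreserving_eval (fun _ : Fin n => X) i).lintegral_comp
      (f := fun k : ℕ => (k : ℝ≥0∞)) measurable_from_top
  rw [lintegral_map measurable_from_top (by fun_prop)]
  simp only [Nat.cast_sum]
  rw [lintegral_finsetSum _ fun i _ => by fun_prop]
  simp [eval_mean]

/-- Discrete Wald's lemma: the mean of the compound distribution, the distribution of
the sum of `N`-many i.i.d. draws from `X`, is the product of the means. -/
theorem discrete_wald (N X : Measure ℕ) [IsProbabilityMeasure N] [IsProbabilityMeasure X] :
    ∫⁻ k, (k : ℝ≥0∞) ∂(N.bind fun n =>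
        Measure.map (fun v : Fin n → ℕ => ∑ i, v i) (Measure.pi fun _ : Fin n => X))
      = (∫⁻ n, (n : ℝ≥0∞) ∂N) * ∫⁻ k, (k : ℝ≥0∞) ∂X := by
  rw [Measure.lintegral_bind measurable_from_top.aemeasurable measurable_from_top.aemeasurable]
  simp only [lintegral_map_sum_pi]
  exact lintegral_mul_const _ measurable_from_top
end
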